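/- Let 𝒜 be a semiprime uniformly complete f-algebra and let p ∈ ℕ with p ≥ 2. If g₁, …, g_p ∈ 𝒜₊ are positive elements whose product g₁⋯g_p is a finite element of the product algebra Π_p(𝒜), then the (unique) positive p-th root (g₁⋯g_p)^(1/p) is a finite element of 𝒜. Consequently, every element of Π_p(𝒜) that is finite in Π_p(𝒜) is also finite in 𝒜, i.e. Φ₁(Π_p(𝒜)) ⊆ Φ₁(𝒜). -/

import Mathlib

namespace FiniteElementsPaper

/-- Product of `p` factors `φ 0 * φ 1 * ⋯ * φ (p-1)` in a (possibly non-unital)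
multiplicative structure; junk value `0` when `p = 0`. -/
def mulProd {A : Type*} [Mul A] [Zero A] : (p : ℕ) → (Fin p → A) → A
  | 0, _ => 0
  | q + 1, φ => Fin.foldl q (fun acc i => acc * φ i.succ) (φ 0)

/-- `p`-th power `a^p` (junk value `0` for `p = 0`). -/
def mpow {A : Type*} [Mul A] [Zero A] (a : A) (p : ℕ) : A :=
  mulProd p (fun _ => a)

/-- The set `Π_p(𝒜)` of all `p`-fold products. -/
def piSet (A : Type*) [Mul A] [Zero A] (p : ℕ) : Set A :=
  {x | ∃ φ : Fin p → A, x = mulProd p φ}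

variable {A : Type*} [Lattice A] [AddCommGroup A] [Module ℝ A]

/-- `z` is a majorant of `φ`: `z ≥ 0` and for every `x` there is `c > 0` with
`|x| ⊓ n • |φ| ≤ c • z` for all `n`. -/
def IsMajorant (z φ : A) : Prop :=
  0 ≤ z ∧ ∀ x : A, ∃ c : ℝ, 0 < c ∧ ∀ n : ℕ, |x| ⊓ n • |φ| ≤ c • z

/-- `φ` is a finite element. -/
def IsFiniteElt (φ : A) : Prop := ∃ z : A, IsMajorant z φ

/-- `φ` is a totally finite element: it has a majorant which is itself finite. -/
def IsTotallyFiniteElt (φ : A) : Prop := ∃ z : A, IsMajorant z φ ∧ IsFiniteElt z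

/-- `φ` is self-majorizing: `|φ|` is a majorant of `φ`. -/
def IsSelfMajorizing (φ : A) : Prop := IsMajorant |φ| φ

/-- `φ ∈ Φ₃(A) = S₊(A) - S₊(A)`. -/
def InPhi3 (φ : A) : Prop :=
  ∃ s t : A, 0 ≤ s ∧ 0 ≤ t ∧ IsSelfMajorizing s ∧ IsSelfMajorizing t ∧ φ = s - t

/-- `w` is a majorant of `φ` relative to the subset `S` (all lattice operations
computed in the ambient algebra). -/
def IsMajorantIn (S : Set A) (w φ : A) : Prop :=
  0 ≤ w ∧ ∀ x ∈ S, ∃ c : ℝ, 0 < c ∧ ∀ n : ℕ, |x| ⊓ n • |φ| ≤ c • w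

/-- `φ` is a finite element of the sublattice `S` (majorant required to lie in `S`). -/
def IsFiniteEltIn (S : Set A) (φ : A) : Prop := ∃ w ∈ S, IsMajorantIn S w φ

/-- `φ` is a totally finite element of the sublattice `S`. -/
def IsTotallyFiniteEltIn (S : Set A) (φ : A) : Prop :=
  ∃ w ∈ S, IsMajorantIn S w φ ∧ IsFiniteEltIn S w

/-- `φ` is self-majorizing in the sublattice `S`. -/
def IsSelfMajorizingIn (S : Set A) (φ : A) : Prop := IsMajorantIn S |φ| φ

/-- `φ ∈ Φ₃(S) = S₊(S) - S₊(S)` for the sublattice `S`. -/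
def InPhi3In (S : Set A) (φ : A) : Prop :=
  ∃ s t : A, s ∈ S ∧ t ∈ S ∧ 0 ≤ s ∧ 0 ≤ t ∧
    IsSelfMajorizingIn S s ∧ IsSelfMajorizingIn S t ∧ φ = s - t

variable (A) in
/-- Archimedean ℓ-algebra structure: an Archimedean vector lattice together with an
associative bilinear multiplication whose product of positive elements is positive. -/
structure IsLAlgebra [Mul A] : Prop where
  add_le_add_left : ∀ a b : A, a ≤ b → ∀ c : A, c + a ≤ c + b
  smul_le_smul : ∀ (r : ℝ) (a b : A), 0 ≤ r → a ≤ b → r • a ≤ r • b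
  archimedean : ∀ a b : A, 0 ≤ a → (∀ n : ℕ, n • a ≤ b) → a = 0
  mul_assoc : ∀ a b c : A, a * b * c = a * (b * c)
  left_distrib : ∀ a b c : A, a * (b + c) = a * b + a * c
  right_distrib : ∀ a b c : A, (a + b) * c = a * c + b * c
  smul_mul : ∀ (r : ℝ) (a b : A), (r • a) * b = r • (a * b)
  mul_smul : ∀ (r : ℝ) (a b : A), a * (r • b) = r • (a * b)
  mul_nonneg : ∀ a b : A, 0 ≤ a → 0 ≤ b → 0 ≤ a * b

variable (A) in
/-- A `d`-algebra: ℓ-algebra in which `a ⊓ b = 0` implies `(a*c) ⊓ (b*c) = (c*a) ⊓ (c*b) = 0`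
for all `c ≥ 0`. -/
structure IsDAlgebra [Mul A] extends IsLAlgebra A : Prop where
  d_prop : ∀ a b c : A, a ⊓ b = 0 → 0 ≤ c → (a * c) ⊓ (b * c) = 0 ∧ (c * a) ⊓ (c * b) = 0

variable (A) in
/-- An `f`-algebra: ℓ-algebra in which `a ⊓ b = 0` implies `(a*c) ⊓ b = (c*a) ⊓ b = 0`
for all `c ≥ 0`. -/
structure IsFAlgebra [Mul A] extends IsLAlgebra A : Prop where
  f_prop : ∀ a b c : A, a ⊓ b = 0 → 0 ≤ c → (a * c) ⊓ b = 0 ∧ (c * a) ⊓ b = 0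

/-- `e` is a multiplicative unit. -/
def IsMulUnit [Mul A] (e : A) : Prop := ∀ a : A, a * e = a ∧ e * a = a

/-- `e` is an order unit. -/
def IsOrderUnit (e : A) : Prop := 0 ≤ e ∧ ∀ x : A, ∃ l : ℝ, 0 ≤ l ∧ |x| ≤ l • e

variable (A) in
/-- The algebra is semiprime: `0` is its only nilpotent element. -/
def IsSemiprime [Mul A] [Zero A] : Prop :=
  ∀ (a : A) (n : ℕ), 0 < n → mpow a n = 0 → a = 0

variable (A) in
/-- The vector lattice is uniformly complete. -/
def UniformlyComplete : Prop :=
  ∀ u : A, 0 ≤ u → ∀ f : ℕ → A,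
    (∀ ε : ℝ, 0 < ε → ∃ K : ℕ, ∀ m n : ℕ, K ≤ m → K ≤ n → |f m - f n| ≤ ε • u) →
    ∃ a : A, ∀ ε : ℝ, 0 < ε → ∃ K : ℕ, ∀ n : ℕ, K ≤ n → |f n - a| ≤ ε • u

variable (A) in
/-- The weak factorization property: every element is dominated by a product. -/
def WeakFactorization [Mul A] : Prop := ∀ a : A, ∃ b c : A, a ≤ b * c


/-- The non-unital ring underlying an `f`-algebra. -/
abbrev IsFAlgebra.nonUnitalRing {A : Type*} [Lattice A] [AddCommGroup A] [Module ℝ A] [Mul A]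
    (hA : IsFAlgebra A) : NonUnitalRing A :=
  { ‹AddCommGroup A›, ‹Mul A› with
    left_distrib := hA.left_distrib
    right_distrib := hA.right_distrib
    zero_mul := fun a => by simpa using hA.smul_mul 0 0 a
    mul_zero := fun a => by simpa using hA.mul_smul 0 a 0
    mul_assoc := hA.mul_assoc }

theorem IsFAlgebra.isOrderedAddMonoid {A : Type*} [Lattice A] [AddCommGroup A] [Module ℝ A]
    [Mul A] (hA : IsFAlgebra A) : IsOrderedAddMonoid A where
  add_le_add_left a b h c := by
    simpa only [add_comm c] using hA.add_le_add_left a b h c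

theorem mulProd_one {A : Type*} [Mul A] [Zero A] (φ : Fin 1 → A) : mulProd 1 φ = φ 0 := by
  simp [mulProd]

theorem mulProd_succ_succ {A : Type*} [Mul A] [Zero A] (k : ℕ) (φ : Fin (k + 2) → A) :
    mulProd (k + 2) φ = mulProd (k + 1) (fun i => φ i.castSucc) * φ (Fin.last (k + 1)) := by
  simp [mulProd, Fin.foldl_succ_last]

theorem mpow_one {A : Type*} [Mul A] [Zero A] (a : A) : mpow a 1 = a :=
  mulProd_one _

theorem mpow_succ_succ {A : Type*} [Mul A] [Zero A] (a : A) (k : ℕ) :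
    mpow a (k + 2) = mpow a (k + 1) * a :=
  mulProd_succ_succ k _

theorem mpow_mem_piSet {A : Type*} [Mul A] [Zero A] (a : A) (p : ℕ) : mpow a p ∈ piSet A p :=
  ⟨_, rfl⟩

theorem mul_mpow_comm {A : Type*} [NonUnitalRing A] (a : A) (k : ℕ) :
    a * mpow a (k + 1) = mpow a (k + 1) * a := by
  induction k with
  | zero => rw [zero_add, mpow_one]
  | succ k ih => rw [mpow_succ_succ, ← mul_assoc, ih]

theorem mpow_nsmul {A : Type*} [NonUnitalRing A] (m : ℕ) (a : A) (k : ℕ) :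
    mpow (m • a) (k + 1) = m ^ (k + 1) • mpow a (k + 1) := by
  induction k with
  | zero => simp [mpow_one]
  | succ k ih => rw [mpow_succ_succ, mpow_succ_succ, ih, smul_mul_smul_comm, pow_succ _ (k + 1)]

section Ring

variable {A : Type*} [Lattice A] [NonUnitalRing A] [Module ℝ A] [IsOrderedAddMonoid A]

namespace IsFAlgebra

variable (hA : IsFAlgebra A)
include hA

theorem mul_le_mul_left {a b c : A} (h : a ≤ b) (hc : 0 ≤ c) : c * a ≤ c * b := by
  rw [← sub_nonneg, ← mul_sub]
  exact hA.mul_nonneg _ _ hc (sub_nonneg.2 h)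

theorem mul_le_mul_right {a b c : A} (h : a ≤ b) (hc : 0 ≤ c) : a * c ≤ b * c := by
  rw [← sub_nonneg, ← sub_mul]
  exact hA.mul_nonneg _ _ (sub_nonneg.2 h) hc

theorem mul_le_mul {a b c d : A} (hab : a ≤ b) (hcd : c ≤ d) (hc : 0 ≤ c) (hb : 0 ≤ b) :
    a * c ≤ b * d :=
  (hA.mul_le_mul_right hab hc).trans (hA.mul_le_mul_left hcd hb)

theorem mpow_nonneg {a : A} (ha : 0 ≤ a) (k : ℕ) : 0 ≤ mpow a (k + 1) := by
  induction k with
  | zero => rwa [zero_add, mpow_one]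
  | succ k ih => rw [mpow_succ_succ]; exact hA.mul_nonneg _ _ ih ha

theorem mpow_le_mpow {a b : A} (ha : 0 ≤ a) (h : a ≤ b) (k : ℕ) :
    mpow a (k + 1) ≤ mpow b (k + 1) := by
  induction k with
  | zero => rwa [zero_add, mpow_one, mpow_one]
  | succ k ih =>
    rw [mpow_succ_succ, mpow_succ_succ]
    exact hA.mul_le_mul ih h ha (hA.mpow_nonneg (ha.trans h) k)

theorem smul_nonneg {c : ℝ} {a : A} (hc : 0 ≤ c) (ha : 0 ≤ a) : 0 ≤ c • a := by
  simpa using hA.smul_le_smul c 0 a hc ha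

theorem smul_le_smul_right {c d : ℝ} {a : A} (h : c ≤ d) (ha : 0 ≤ a) : c • a ≤ d • a := by
  rw [← sub_nonneg, ← sub_smul]
  exact hA.smul_nonneg (sub_nonneg.2 h) ha

theorem smul_mpow_le {c : ℝ} (hc : 1 ≤ c) {a : A} (ha : 0 ≤ a) (k : ℕ) :
    c • mpow a (k + 1) ≤ mpow (c • a) (k + 1) := by
  have hc0 : (0 : ℝ) ≤ c := zero_le_one.trans hc
  induction k with
  | zero => rw [zero_add, mpow_one, mpow_one]
  | succ k ih =>
    have hle : a ≤ c • a := by simpa using hA.smul_le_smul_right hc ha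
    rw [mpow_succ_succ, mpow_succ_succ, ← hA.smul_mul]
    exact hA.mul_le_mul ih hle ha (hA.mpow_nonneg (hA.smul_nonneg hc0 ha) k)

theorem mul_le_abs_mul_abs (a b : A) : a * b ≤ |a| * |b| := by
  have h₁ : a⁺ * b ≤ a⁺ * |b| := hA.mul_le_mul_left (le_abs_self b) (posPart_nonneg a)
  have h₂ : a⁻ * -b ≤ a⁻ * |b| := hA.mul_le_mul_left (neg_le_abs b) (negPart_nonneg a)
  calc a * b = a⁺ * b + a⁻ * -b := by
        rw [mul_neg, ← sub_eq_add_neg, ← sub_mul, posPart_sub_negPart]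
    _ ≤ a⁺ * |b| + a⁻ * |b| := add_le_add h₁ h₂
    _ = |a| * |b| := by rw [← add_mul, posPart_add_negPart]

theorem abs_mul_le (a b : A) : |a * b| ≤ |a| * |b| := by
  refine abs_le'.2 ⟨hA.mul_le_abs_mul_abs a b, ?_⟩
  simpa using hA.mul_le_abs_mul_abs a (-b)

theorem abs_mulProd_le (k : ℕ) (φ : Fin (k + 1) → A) {v : A} (hv : ∀ i, |φ i| ≤ v) :
    |mulProd (k + 1) φ| ≤ mpow v (k + 1) := by
  induction k with
  | zero => exact (congrArg abs (mulProd_one φ)).trans_le ((hv 0).trans (mpow_one v).ge)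
  | succ k ih =>
    rw [mpow_succ_succ, mulProd_succ_succ]
    exact (hA.abs_mul_le _ _).trans (hA.mul_le_mul (ih _ fun i => hv _) (hv _) (abs_nonneg _)
      (hA.mpow_nonneg ((abs_nonneg _).trans (hv 0)) k))

theorem exists_le_mpow {k : ℕ} {w : A} (hw : w ∈ piSet A (k + 1)) :
    ∃ v : A, 0 ≤ v ∧ w ≤ mpow v (k + 1) := by
  obtain ⟨φ, rfl⟩ := hw
  refine ⟨∑ i, |φ i|, Finset.sum_nonneg fun i _ => abs_nonneg _,
    (le_abs_self _).trans (hA.abs_mulProd_le k φ fun i => ?_)⟩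
  exact Finset.single_le_sum (f := fun i => |φ i|) (fun i _ => abs_nonneg _) (Finset.mem_univ i)

theorem mul_eq_zero_of_inf_eq_zero {a b : A} (h : a ⊓ b = 0) : a * b = 0 := by
  have ha : 0 ≤ a := h ▸ inf_le_left
  have hb : 0 ≤ b := h ▸ inf_le_right
  have h₁ : b ⊓ (a * b) = 0 := by rw [inf_comm]; exact (hA.f_prop a b b h hb).1
  simpa using (hA.f_prop b (a * b) a h₁ ha).2

theorem inf_eq_zero_of_mul_eq_zero (hsp : IsSemiprime A) {a b : A} (ha : 0 ≤ a) (hb : 0 ≤ b)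
    (h : a * b = 0) : a ⊓ b = 0 := by
  have h0 : 0 ≤ a ⊓ b := le_inf ha hb
  refine hsp _ 2 two_pos ?_
  rw [mpow_succ_succ, mpow_one]
  exact le_antisymm (h ▸ hA.mul_le_mul inf_le_left inf_le_right h0 ha) (hA.mul_nonneg _ _ h0 h0)

theorem le_of_mpow_le_mpow (hsp : IsSemiprime A) {a b : A} (ha : 0 ≤ a) (hb : 0 ≤ b) (k : ℕ)
    (h : mpow a (k + 1) ≤ mpow b (k + 1)) : a ≤ b := by
  set d := (a - b)⁺ with hd
  set e := (a - b)⁻ with he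
  have hde : d ⊓ e = 0 := posPart_inf_negPart_eq_zero _
  have hd0 : 0 ≤ d := posPart_nonneg _
  have hda : d ≤ a := sup_le (sub_le_self _ hb) ha
  have hab : a = b + d - e := by
    rw [add_sub_assoc, hd, he, posPart_sub_negPart]; abel
  have key : ∀ u : A, u ⊓ e = 0 → u * a = u * b + u * d := fun u hu => by
    rw [hab, mul_sub, hA.mul_eq_zero_of_inf_eq_zero hu, sub_zero, mul_add]
  have main : ∀ j : ℕ, d * mpow b (j + 1) + d * mpow d (j + 1) ≤ d * mpow a (j + 1) := by
    intro j
    induction j with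
    | zero => simp only [zero_add, mpow_one]; exact (key d hde).ge
    | succ j ih =>
      have hb' := hA.mpow_nonneg hb j
      have hd' := hA.mpow_nonneg hd0 j
      simp only [mpow_succ_succ, ← mul_assoc]
      refine le_trans ?_ (hA.mul_le_mul_right ih ha)
      rw [add_mul, key _ (hA.f_prop d e _ hde hb').1]
      exact add_le_add
        (le_add_of_nonneg_right (hA.mul_nonneg _ _ (hA.mul_nonneg _ _ hd0 hb') hd0))
        (hA.mul_le_mul_left hda (hA.mul_nonneg _ _ hd0 hd'))
  have hle : d * mpow d (k + 1) ≤ 0 := by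
    have := (main k).trans (hA.mul_le_mul_left h hd0)
    simpa using this
  have hzero : mpow d (k + 2) = 0 := by
    rw [mpow_succ_succ, ← mul_mpow_comm]
    exact le_antisymm hle (hA.mul_nonneg _ _ hd0 (hA.mpow_nonneg hd0 k))
  have := hsp d (k + 2) (Nat.succ_pos _) hzero
  exact sub_nonpos.1 (posPart_eq_zero.1 this)

/-- An upper bound of all truncations `s ⊓ m • b` of `s` also bounds `s`, provided that `s` is
dominated by a multiple of `b`. -/
theorem le_of_forall_inf_nsmul_le (hsp : IsSemiprime A) {s b t u : A} (hb : 0 ≤ b) (ht : 0 ≤ t)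
    (hu : 0 ≤ u) (hs : s ≤ t * b) (h : ∀ m : ℕ, s ⊓ m • b ≤ u) : s ≤ u := by
  set r := (s - u)⁺ with hr
  have hr0 : 0 ≤ r := posPart_nonneg _
  have hle : ∀ m : ℕ, m • (r * b) ≤ r * u := fun m => by
    have hdisj : r ⊓ (m • b - u)⁺ = 0 := by
      let := AddCommGroup.toDistribLattice A
      have := sup_inf_right (s - u) (m • b - u) 0
      rw [hr, posPart_def, posPart_def, ← this, ← inf_sub, sup_eq_right]
      exact sub_nonpos.2 (h m)
    have h₁ : r * (m • b - u) ≤ 0 :=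
      (hA.mul_le_mul_left (le_posPart _) hr0).trans (hA.mul_eq_zero_of_inf_eq_zero hdisj).le
    rwa [mul_sub, sub_nonpos, mul_smul_comm] at h₁
  have hrb : r * b = 0 := hA.archimedean _ _ (hA.mul_nonneg _ _ hr0 hb) hle
  have hinf : r ⊓ (t * b) = 0 := by
    rw [inf_comm]
    refine (hA.f_prop b r t ?_ ht).2
    rw [inf_comm]
    exact hA.inf_eq_zero_of_mul_eq_zero hsp hr0 hb hrb
  have hrt : r ≤ t * b := sup_le ((sub_le_self _ hu).trans hs) (hA.mul_nonneg _ _ ht hb)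
  rw [inf_eq_left.2 hrt] at hinf
  exact sub_nonpos.1 (posPart_eq_zero.1 hinf)

/-- A finite element of `Π_p(𝒜)` has a majorant which is a `p`-th power, up to moving the
constants inside the power. -/
theorem exists_forall_inf_le_mpow {k : ℕ} {x : A} (hx : IsFiniteEltIn (piSet A (k + 1)) x) :
    ∃ v : A, 0 ≤ v ∧ ∀ y : A, ∃ c : ℝ, 0 < c ∧
      ∀ n : ℕ, mpow |y| (k + 1) ⊓ n • |x| ≤ mpow (c • v) (k + 1) := by
  obtain ⟨w, hw, hw0, hmaj⟩ := hx
  obtain ⟨v, hv, hwv⟩ := hA.exists_le_mpow hw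
  refine ⟨v, hv, fun y => ?_⟩
  obtain ⟨c, -, hcle⟩ := hmaj _ (mpow_mem_piSet |y| (k + 1))
  refine ⟨max c 1, lt_max_of_lt_right one_pos, fun n => ?_⟩
  calc mpow |y| (k + 1) ⊓ n • |x| ≤ c • w := by
        simpa only [abs_of_nonneg (hA.mpow_nonneg (abs_nonneg y) k)] using hcle n
    _ ≤ max c 1 • w := hA.smul_le_smul_right (le_max_left _ _) hw0
    _ ≤ max c 1 • mpow v (k + 1) :=
        hA.smul_le_smul _ _ _ (zero_le_one.trans (le_max_right _ _)) hwv
    _ ≤ mpow (max c 1 • v) (k + 1) := hA.smul_mpow_le (le_max_right _ _) hv k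

theorem isFiniteElt_of_mpow (hsp : IsSemiprime A) {k : ℕ} {b : A} (hb : 0 ≤ b)
    (h : IsFiniteEltIn (piSet A (k + 1)) (mpow b (k + 1))) : IsFiniteElt b := by
  obtain ⟨v, hv, hmaj⟩ := hA.exists_forall_inf_le_mpow h
  refine ⟨v, hv, fun y => ?_⟩
  obtain ⟨c, hc, hle⟩ := hmaj y
  refine ⟨c, hc, fun n => ?_⟩
  have h0 : 0 ≤ |y| ⊓ n • b := le_inf (abs_nonneg y) (nsmul_nonneg hb n)
  rw [abs_of_nonneg hb]
  refine hA.le_of_mpow_le_mpow hsp h0 (hA.smul_nonneg hc.le hv) k (le_trans ?_ (hle (n ^ (k + 1))))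
  rw [abs_of_nonneg (hA.mpow_nonneg hb k), ← mpow_nsmul]
  exact le_inf (hA.mpow_le_mpow h0 inf_le_left k) (hA.mpow_le_mpow h0 inf_le_right k)

theorem isFiniteElt_of_isFiniteEltIn (hsp : IsSemiprime A) {k : ℕ} {x : A}
    (h : IsFiniteEltIn (piSet A (k + 2)) x) : IsFiniteElt x := by
  obtain ⟨v, hv, hmaj⟩ := hA.exists_forall_inf_le_mpow h
  refine ⟨v, hv, fun y => ?_⟩
  obtain ⟨c, hc, hle⟩ := hmaj y
  refine ⟨c, hc, fun n => ?_⟩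
  set s := |y| ⊓ n • |x| with hs
  have h0 : 0 ≤ s := le_inf (abs_nonneg y) (nsmul_nonneg (abs_nonneg x) n)
  have hcv : 0 ≤ c • v := hA.smul_nonneg hc.le hv
  have hP : 0 ≤ mpow s (k + 1) := hA.mpow_nonneg h0 k
  refine hA.le_of_mpow_le_mpow hsp h0 hcv (k + 1) ?_
  refine hA.le_of_forall_inf_nsmul_le hsp (abs_nonneg x) (t := n • mpow s (k + 1))
    (nsmul_nonneg hP n) (hA.mpow_nonneg hcv (k + 1)) ?_ fun m => ?_
  · rw [mpow_succ_succ, smul_mul_assoc, ← mul_smul_comm]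
    exact hA.mul_le_mul_left inf_le_right hP
  · exact (inf_le_inf_right _ (hA.mpow_le_mpow h0 inf_le_left (k + 1))).trans (hle m)

end IsFAlgebra

end Ring

/-- In a semiprime uniformly complete f-algebra, if a product of positive
elements is finite in `Π_p(𝒜)`, then its positive p-th root is finite in `𝒜`; consequently
`Φ₁(Π_p(𝒜)) ⊆ Φ₁(𝒜)`. -/
theorem stmt15 {A : Type*} [Lattice A] [AddCommGroup A] [Module ℝ A] [Mul A]
    (hA : IsFAlgebra A) (hsp : IsSemiprime A) (huc : UniformlyComplete A)
    (p : ℕ) (hp : 2 ≤ p) :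
    (∀ g : Fin p → A, (∀ i, 0 ≤ g i) → IsFiniteEltIn (piSet A p) (mulProd p g) →
      ∀ b : A, 0 ≤ b → mpow b p = mulProd p g → IsFiniteElt b) ∧
    (∀ x ∈ piSet A p, IsFiniteEltIn (piSet A p) x → IsFiniteElt x) := by
  obtain ⟨k, rfl⟩ := Nat.exists_eq_add_of_le' hp
  let := hA.nonUnitalRing
  have := hA.isOrderedAddMonoid
  refine ⟨fun g _ hg b hb hbg => ?_, fun x _ hx => ?_⟩
  · exact IsFAlgebra.isFiniteElt_of_mpow (k := k + 1) hA hsp hb (hbg ▸ hg)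
  · exact IsFAlgebra.isFiniteElt_of_isFiniteEltIn hA hsp hx

end FiniteElementsPaper
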